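/- Let z = x + iy be a complex number with 0 < x - y < 1, and let L be the line through 0 in direction e^{iπ/4}, parametrized as ζ = e^{iπ/4}u for u ∈ ℝ. Then the integral ∫_L e^{-zζ}/(1 + e^{-ζ}) dζ converges absolutely and equals π/sin(πz). -/

import Mathlib

open Complex MeasureTheory Set

noncomputable section

/-- `ω = e^{iπ/4}`. -/
def ω : ℂ := Complex.exp (Real.pi * Complex.I / 4)

/-- Hermite function of complex order `ν`, defined by its power series
(Lebedev (10.4.3)): `H_ν(z) = (1/(2Γ(-ν))) Σ_n Γ((n-ν)/2)(-2z)^n/n!`. -/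
def HermiteF (ν z : ℂ) : ℂ :=
  (1 / (2 * Complex.Gamma (-ν))) *
    ∑' n : ℕ, Complex.Gamma (((n : ℂ) - ν) / 2) * (-2 * z) ^ n / (Nat.factorial n : ℂ)

/-- Riemann's auxiliary function `ℛ(s) = ∫_{0↙1} x^{-s} e^{πix²}/(e^{πix}-e^{-πix}) dx`,
with the path parametrized as `x = 1/2 - ω u`, `u ∈ ℝ`, so `dx = -ω du`. -/
def RiemannR (s : ℂ) : ℂ :=
  ∫ u : ℝ, (-ω) * ((1 / 2 - ω * u) ^ (-s) *
      Complex.exp (Real.pi * Complex.I * (1 / 2 - ω * u) ^ 2) /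
    (Complex.exp (Real.pi * Complex.I * (1 / 2 - ω * u)) -
      Complex.exp (-(Real.pi : ℂ) * Complex.I * (1 / 2 - ω * u))))

/-- Parabolic cylinder function `U(a,z)`, expressed through the Hermite function via
`U(-ν-1/2,z) = 2^{-ν/2} e^{-z²/4} H_ν(z/√2)`. -/
def cylinderU (a z : ℂ) : ℂ :=
  (2 : ℂ) ^ (a / 2 + 1 / 4) * Complex.exp (-z ^ 2 / 4) *
    HermiteF (-a - 1 / 2) (z / (Real.sqrt 2 : ℂ))

/-- Whittaker's parabolic cylinder function `D_ν(z) = U(-ν-1/2, z)`. -/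
def whittakerD (ν z : ℂ) : ℂ := cylinderU (-ν - 1 / 2) z

open Filter Topology

lemma omega_eq : ω = ((Real.sqrt 2 / 2 : ℝ) : ℂ) * (1 + Complex.I) := by
  unfold ω
  rw [show (Real.pi * Complex.I / 4 : ℂ) = ((Real.pi / 4 : ℝ) : ℂ) * Complex.I by push_cast; ring,
    Complex.exp_mul_I, ← Complex.ofReal_cos, ← Complex.ofReal_sin, Real.cos_pi_div_four,
    Real.sin_pi_div_four]
  ring

lemma omega_mul_re (a : ℂ) : (a * ω).re = Real.sqrt 2 / 2 * (a.re - a.im) := by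
  rw [omega_eq]; simp; ring

lemma norm_omega : ‖ω‖ = 1 := by
  unfold ω
  rw [show (Real.pi * Complex.I / 4 : ℂ) = ((Real.pi / 4 : ℝ) : ℂ) * Complex.I by push_cast; ring,
    Complex.norm_exp_ofReal_mul_I]

lemma den_bound (u : ℝ) (hu : 0 ≤ u) : 1 / 2 ≤ ‖1 + Complex.exp (-(ω * u))‖ := by
  set t : ℝ := Real.sqrt 2 / 2 * u with ht
  have ht0 : 0 ≤ t := by positivity
  have e : -(ω * u) = ((-t : ℝ) : ℂ) + ((-t : ℝ) : ℂ) * Complex.I := by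
    rw [omega_eq, ht]; push_cast; ring
  refine le_trans ?_ (Complex.re_le_norm _)
  rw [e, Complex.add_re, Complex.exp_re]
  simp only [Complex.add_re, Complex.add_im, Complex.ofReal_re, Complex.ofReal_im,
    Complex.re_ofReal_mul, Complex.im_ofReal_mul, Complex.I_re, Complex.I_im, mul_zero, mul_one,
    add_zero, zero_add, Complex.one_re, Real.cos_neg]
  rcases le_total t 1 with h | h
  · have : 0 ≤ Real.cos t :=
      Real.cos_nonneg_of_neg_pi_div_two_le_of_le (by linarith [Real.pi_pos])
        (by linarith [Real.pi_gt_three])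
    have := mul_nonneg (Real.exp_pos (-t)).le this
    linarith
  · have h2 : 2 ≤ Real.exp t := by linarith [Real.add_one_le_exp t]
    have h3 : Real.exp (-t) ≤ 1 / 2 := by
      rw [Real.exp_neg, inv_le_comm₀ (Real.exp_pos t) (by norm_num)]
      linarith
    have := Real.neg_one_le_cos t
    nlinarith [Real.exp_pos (-t)]

def gK (a : ℂ) (u : ℝ) : ℂ :=
  ω * (Complex.exp (-a * (ω * u)) / (1 + Complex.exp (-(ω * u))))

lemma gK_bound (a : ℂ) (u : ℝ) (hu : 0 ≤ u) :
    ‖gK a u‖ ≤ 2 * Real.exp ((-(a * ω).re) * u) := by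
  have hd := den_bound u hu
  unfold gK
  rw [norm_mul, norm_omega, one_mul, norm_div, Complex.norm_exp,
    show (-a * (ω * u)).re = (-(a * ω).re) * u by
      rw [show -a * (ω * u) = ((-u : ℝ) : ℂ) * (a * ω) by push_cast; ring, Complex.re_ofReal_mul]
      ring,
    div_le_iff₀ (by linarith)]
  nlinarith [Real.exp_pos ((-(a * ω).re) * u)]

lemma gK_int (a : ℂ) (ha : 0 < (a * ω).re) : IntegrableOn (gK a) (Ioi 0) := by
  refine Integrable.mono' ((integrableOn_exp_mul_Ioi (a := -(a * ω).re) (by linarith) 0).const_mul 2)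
    ?_ ?_
  · apply Measurable.aestronglyMeasurable
    unfold gK
    fun_prop
  · exact (ae_restrict_iff' measurableSet_Ioi).2 (ae_of_all _ fun u hu => gK_bound a u (le_of_lt hu))

lemma K_bound (a : ℂ) (ha : 0 < (a * ω).re) :
    ‖∫ u in Ioi (0 : ℝ), gK a u‖ ≤ 2 / (a * ω).re := by
  have := norm_integral_le_of_norm_le
    ((integrableOn_exp_mul_Ioi (a := -(a * ω).re) (by linarith) 0).const_mul 2)
    ((ae_restrict_iff' measurableSet_Ioi).2 (ae_of_all _ fun u hu => gK_bound a u (le_of_lt hu)))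
  refine this.trans (le_of_eq ?_)
  rw [integral_const_mul, integral_exp_mul_Ioi (by linarith)]
  generalize (a * ω).re = r
  simp [div_eq_mul_inv]

lemma omega_re_one : 0 < ω.re := by
  have := omega_mul_re 1
  simp at this
  rw [this]; positivity

lemma K_rec (a : ℂ) (ha : 0 < (a * ω).re) :
    (∫ u in Ioi (0 : ℝ), gK a u) + (∫ u in Ioi (0 : ℝ), gK (a + 1) u) = 1 / a := by
  have ha1 : 0 < ((a + 1) * ω).re := by
    rw [add_mul, one_mul, Complex.add_re]; linarith [omega_re_one]
  rw [← integral_add (gK_int a ha) (gK_int _ ha1)]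
  have : ∀ u ∈ Ioi (0 : ℝ), gK a u + gK (a + 1) u = ω * Complex.exp (-(a * ω) * u) := by
    intro u hu
    have hd := den_bound u (le_of_lt hu)
    have hne : 1 + Complex.exp (-(ω * u)) ≠ 0 := by
      intro h; rw [h] at hd; norm_num at hd
    unfold gK
    rw [show -(a + 1) * (ω * u) = -a * (ω * u) + -(ω * u) by ring, Complex.exp_add,
      show -(a * ω) * u = -a * (ω * u) by ring]
    field_simp
  rw [setIntegral_congr_fun measurableSet_Ioi this, integral_const_mul,
    integral_exp_mul_complex_Ioi (by simpa using ha)]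
  have h1 : a * ω ≠ 0 := by intro h; rw [h] at ha; simp at ha
  have h2 := left_ne_zero_of_mul h1
  have h3 := right_ne_zero_of_mul h1
  simp
  field_simp

lemma re_add_nat (a : ℂ) (n : ℕ) : ((a + n) * ω).re = (a * ω).re + n * ω.re := by
  rw [add_mul, Complex.add_re, ← Complex.ofReal_natCast, Complex.re_ofReal_mul]

lemma K_sum (a : ℂ) (ha : 0 < (a * ω).re) (N : ℕ) :
    ∑ n ∈ Finset.range N, (-1 : ℂ) ^ n / (a + n) =
      (∫ u in Ioi (0 : ℝ), gK a u) - (-1) ^ N * ∫ u in Ioi (0 : ℝ), gK (a + N) u := by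
  induction N with
  | zero => simp
  | succ N ih =>
    have h := K_rec (a + N) (by rw [re_add_nat]; have := omega_re_one; positivity)
    rw [Finset.sum_range_succ, ih, div_eq_mul_one_div, ← h]
    push_cast
    rw [← add_assoc]
    ring

lemma K_tendsto (a : ℂ) (ha : 0 < (a * ω).re) :
    Tendsto (fun N : ℕ => ∑ n ∈ Finset.range N, (-1 : ℂ) ^ n / (a + n)) atTop
      (𝓝 (∫ u in Ioi (0 : ℝ), gK a u)) := by
  simp_rw [K_sum a ha]
  rw [show 𝓝 (∫ u in Ioi (0 : ℝ), gK a u) = 𝓝 ((∫ u in Ioi (0 : ℝ), gK a u) - 0) by simp]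
  refine tendsto_const_nhds.sub ?_
  have hlim : Tendsto (fun N : ℕ => 2 / ((a * ω).re + N * ω.re)) atTop (𝓝 0) := by
    refine tendsto_const_nhds.div_atTop (tendsto_atTop_add_const_left _ _ ?_)
    exact tendsto_natCast_atTop_atTop.atTop_mul_const omega_re_one
  refine squeeze_zero_norm (fun N => ?_) hlim
  rw [norm_mul, norm_pow, norm_neg, norm_one, one_pow, one_mul, ← re_add_nat]
  exact K_bound _ (by rw [re_add_nat]; have := omega_re_one; positivity)

lemma sum_identity (z : ℂ) (N : ℕ) :
    (∑ n ∈ Finset.range (2 * N + 1), (-1 : ℂ) ^ n / (z + n)) +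
      ∑ n ∈ Finset.range (2 * N + 1), (-1 : ℂ) ^ n / (1 - z + n) =
    (1 / 2) * ((1 / (z / 2) + ∑ j ∈ Finset.range N, cotTerm (z / 2) j) +
      (1 / ((1 - z) / 2) + ∑ j ∈ Finset.range N, cotTerm ((1 - z) / 2) j)) := by
  induction N with
  | zero => simp; ring
  | succ N ih =>
    rw [show 2 * (N + 1) + 1 = 2 * N + 1 + 1 + 1 by ring]
    simp only [Finset.sum_range_succ _ (2 * N + 1 + 1), Finset.sum_range_succ _ (2 * N + 1),
      Finset.sum_range_succ _ N]
    have e1 : (-1 : ℂ) ^ (2 * N + 1) = -1 := by rw [pow_succ, pow_mul]; simp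
    have e2 : (-1 : ℂ) ^ (2 * N + 1 + 1) = 1 := by rw [pow_succ, e1]; simp
    rw [e1, e2]
    have half : ∀ w : ℂ, 1 / (w / 2) = 2 * w⁻¹ := fun w => by
      rw [one_div, inv_div, div_eq_mul_inv]
    have c1 : cotTerm (z / 2) N = 2 * (-(1 - z + (2 * N + 1)))⁻¹ + 2 * (z + (2 * N + 2))⁻¹ := by
      rw [cotTerm, ← half, ← half]; congr 2 <;> ring
    have c2 : cotTerm ((1 - z) / 2) N =
        2 * (-(z + (2 * N + 1)))⁻¹ + 2 * (1 - z + (2 * N + 2))⁻¹ := by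
      rw [cotTerm, ← half, ← half]; congr 2 <;> ring
    rw [c1, c2, inv_neg, inv_neg]
    push_cast
    rw [show (2 * (N : ℂ) + 1 + 1) = 2 * N + 2 by ring]
    simp only [div_eq_mul_inv] at ih ⊢
    linear_combination ih

lemma cot_identity (z : ℂ) (hs : Complex.sin (Real.pi * z) ≠ 0) :
    (1 / 2) * (Real.pi * Complex.cot (Real.pi * (z / 2)) +
      Real.pi * Complex.cot (Real.pi * ((1 - z) / 2))) = Real.pi / Complex.sin (Real.pi * z) := by
  have e : (Real.pi * ((1 - z) / 2) : ℂ) = Real.pi / 2 - Real.pi * (z / 2) := by ring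
  rw [e, Complex.cot, Complex.cot, Complex.cos_pi_div_two_sub, Complex.sin_pi_div_two_sub]
  have e2 : (Real.pi * z : ℂ) = 2 * (Real.pi * (z / 2)) := by ring
  rw [e2, Complex.sin_two_mul] at hs ⊢
  have h1 : Complex.cos (Real.pi * (z / 2)) ≠ 0 := right_ne_zero_of_mul hs
  have h2 : Complex.sin (Real.pi * (z / 2)) ≠ 0 := right_ne_zero_of_mul (left_ne_zero_of_mul hs)
  have h3 := Complex.sin_sq_add_cos_sq (Real.pi * (z / 2))
  generalize Complex.cos (Real.pi * (z / 2)) = c at *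
  generalize Complex.sin (Real.pi * (z / 2)) = s at *
  field_simp
  linear_combination h3

lemma gK_neg (z : ℂ) (u : ℝ) : gK z (-u) = gK (1 - z) u := by
  unfold gK
  have h : Complex.exp (-(ω * u)) * Complex.exp (ω * u) = 1 := by
    rw [← Complex.exp_add]; simp
  have e1 : -z * (ω * ((-u : ℝ) : ℂ)) = z * (ω * u) := by push_cast; ring
  have e2 : -(ω * ((-u : ℝ) : ℂ)) = ω * u := by push_cast; ring
  have e3 : -(1 - z) * (ω * u) = z * (ω * u) + -(ω * u) := by ring
  rw [e1, e2, e3, Complex.exp_add]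
  have h4 : 1 + Complex.exp (-(ω * u)) = Complex.exp (-(ω * u)) * (1 + Complex.exp (ω * u)) := by
    linear_combination -h
  rw [h4, mul_comm (Complex.exp (z * (ω * u))), mul_div_mul_left _ _ (Complex.exp_ne_zero _)]

theorem integral_line_eq_pi_div_sin (z : ℂ) (h0 : 0 < z.re - z.im) (h1 : z.re - z.im < 1) :
    Integrable (fun u : ℝ =>
      ω * (Complex.exp (-z * (ω * u)) / (1 + Complex.exp (-(ω * u))))) ∧
    (∫ u : ℝ, ω * (Complex.exp (-z * (ω * u)) / (1 + Complex.exp (-(ω * u)))))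
      = (Real.pi : ℂ) / Complex.sin (Real.pi * z) := by
  change Integrable (gK z) ∧ ∫ u : ℝ, gK z u = _
  have ha : 0 < (z * ω).re := by rw [omega_mul_re]; positivity
  have hb : 0 < ((1 - z) * ω).re := by
    rw [omega_mul_re]
    have : 0 < (1 - z).re - (1 - z).im := by simp; linarith
    positivity
  have hI1 := gK_int z ha
  have hI2 : IntegrableOn (gK z) (Iic 0) := by
    rw [integrableOn_Iic_iff_integrableOn_Iio]
    have := (gK_int (1 - z) hb)
    rw [show (0 : ℝ) = -0 by simp] at this
    have := this.comp_neg_Iio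
    refine this.congr_fun (fun u _ => ?_) measurableSet_Iio
    simp [← gK_neg]
  have hI : Integrable (gK z) := by
    rw [← integrableOn_univ, ← Iic_union_Ioi (a := (0 : ℝ))]
    exact hI2.union hI1
  refine ⟨hI, ?_⟩
  have hsplit : ∫ u : ℝ, gK z u =
      (∫ u in Ioi (0 : ℝ), gK z u) + ∫ u in Ioi (0 : ℝ), gK (1 - z) u := by
    rw [← integral_add_compl measurableSet_Ioi hI, compl_Ioi]
    congr 1
    simp_rw [← gK_neg]
    rw [integral_comp_neg_Ioi]; simp
  have hint : ∀ n : ℤ, (n : ℂ) ≠ z := by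
    rintro n rfl
    simp at h0 h1
    have h1' : n < 1 := by exact_mod_cast h1
    omega
  have hz1 : z / 2 ∈ integerComplement := by
    rw [mem_integerComplement_iff]
    rintro ⟨n, hn⟩
    exact hint (2 * n) (by push_cast; rw [hn]; ring)
  have hz2 : (1 - z) / 2 ∈ integerComplement := by
    rw [mem_integerComplement_iff]
    rintro ⟨n, hn⟩
    exact hint (1 - 2 * n) (by push_cast; rw [hn]; ring)
  have hs : Complex.sin (Real.pi * z) ≠ 0 := by
    rw [Ne, Complex.sin_eq_zero_iff]
    rintro ⟨k, hk⟩
    have hpi : (Real.pi : ℂ) ≠ 0 := by exact_mod_cast Real.pi_ne_zero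
    exact hint k (mul_left_cancel₀ hpi (by rw [hk]; ring))
  rw [hsplit, ← cot_identity z hs]
  have t1 := ((K_tendsto z ha).add (K_tendsto (1 - z) hb)).comp
    (show Tendsto (fun N : ℕ => 2 * N + 1) atTop atTop from
      tendsto_atTop_mono (fun N => by simp only [id]; omega) tendsto_id)
  have t2 := (((tendsto_logDeriv_euler_cot_sub hz1).const_add (1 / (z / 2))).add
    ((tendsto_logDeriv_euler_cot_sub hz2).const_add (1 / ((1 - z) / 2)))).const_mul (1 / 2 : ℂ)
  simp only [add_sub_cancel] at t2
  refine tendsto_nhds_unique t1 (t2.congr fun N => ?_)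
  simp only [Function.comp]
  exact (sum_identity z N).symm
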